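/- Let $U \subsetneq \mathbb{C}$ be a bounded simply connected domain containing $0$ with compact boundary. Suppose that for each $\varepsilon > 0$ there exists $\delta > 0$ such that every subset of $U$ which can be disconnected from $0$ in $U$ by a set $Y$ of Euclidean diameter at most $\delta$ with $Y \cap \partial U \neq \emptyset$ has Euclidean diameter at most $\varepsilon$. Then $\partial U$ is the image of a continuous curve, i.e., there is a continuous surjection from the unit circle onto $\partial U$. -/

import Mathlib

open scoped ENNReal

section

open Set Metric Filter Topology MeasureTheory

/-- Montel's theorem, in ultrafilter form. -/
theorem exists_tendstoLocallyUniformlyOn_of_mapsTo_closedBall {ι : Type*} (𝒰 : Ultrafilter ι)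
    {U : Set ℂ} (hU : IsOpen U) {G : ι → ℂ → ℂ} {R : ℝ} (hd : ∀ i, DifferentiableOn ℂ (G i) U)
    (hm : ∀ i, MapsTo (G i) U (closedBall 0 R)) :
    ∃ g : ℂ → ℂ, TendstoLocallyUniformlyOn G g 𝒰 U := by
  have hlim : ∀ z ∈ U, ∃ y, Tendsto (fun i ↦ G i z) 𝒰 (𝓝 y) := by
    intro z hz
    obtain ⟨y, -, hy⟩ := (isCompact_closedBall (0 : ℂ) R).ultrafilter_le_nhds'
      (𝒰.map fun i ↦ G i z) (Ultrafilter.mem_map.2 (Filter.univ_mem' fun i ↦ hm i hz))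
    exact ⟨y, hy⟩
  choose! g hg using hlim
  refine ⟨g, Metric.tendstoLocallyUniformlyOn_iff.2 fun ε hε a ha ↦ ?_⟩
  obtain ⟨s, hs, hsU⟩ := Metric.isOpen_iff.1 hU a ha
  have hR : 0 ≤ R := by
    obtain ⟨i⟩ := Filter.nonempty_of_neBot (𝒰 : Filter ι)
    exact (norm_nonneg _).trans (by simpa using hm i ha)
  set K := 2 * R / s with hK
  have hK0 : 0 ≤ K := by positivity
  have hLip : ∀ i, ∀ z ∈ ball a s, dist (G i z) (G i a) ≤ K * dist z a := by
    intro i z hz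
    refine Complex.dist_le_div_mul_dist_of_mapsTo_ball ((hd i).mono hsU) (fun w hw ↦ ?_) hz
    have h1 : ‖G i w‖ ≤ R := by simpa using hm i (hsU hw)
    have h2 : ‖G i a‖ ≤ R := by simpa using hm i ha
    rw [mem_closedBall, dist_eq_norm]
    linarith [norm_sub_le (G i w) (G i a)]
  have hLip' : ∀ z ∈ ball a s, dist (g z) (g a) ≤ K * dist z a := fun z hz ↦
    le_of_tendsto ((hg z (hsU hz)).dist (hg a ha)) (Eventually.of_forall fun i ↦ hLip i z hz)
  refine ⟨ball a (min s (ε / (3 * (K + 1)))), mem_nhdsWithin_of_mem_nhds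
    (ball_mem_nhds _ (by positivity)), ?_⟩
  filter_upwards [Metric.tendsto_nhds.1 (hg a ha) (ε / 3) (by positivity)] with i hi z hz
  have hzs : z ∈ ball a s := ball_subset_ball (min_le_left _ _) hz
  have hz' : dist z a < ε / (3 * (K + 1)) := lt_of_lt_of_le hz (min_le_right _ _)
  have hKz : K * dist z a ≤ ε / 3 := by
    rw [lt_div_iff₀ (by positivity)] at hz'
    nlinarith [dist_nonneg (x := z) (y := a)]
  have t := dist_triangle4 (g z) (g a) (G i a) (G i z)
  have h1 := hLip i z hzs
  have h2 := hLip' z hzs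
  rw [dist_comm] at hi h1
  linarith

/-- Hurwitz's theorem, in local form. -/
theorem TendstoLocallyUniformlyOn.eventually_eq_zero_of_ne_zero {ι : Type*} {l : Filter ι}
    [l.NeBot] {V : Set ℂ} (hV : IsOpen V) {F : ι → ℂ → ℂ} {f : ℂ → ℂ}
    (hF : TendstoLocallyUniformlyOn F f l V) (hd : ∀ i, DifferentiableOn ℂ (F i) V)
    (hne : ∀ i, ∀ z ∈ V, F i z ≠ 0) {b : ℂ} (hb : b ∈ V) (hfb : f b = 0) :
    ∀ᶠ z in 𝓝 b, f z = 0 := by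
  have hfd : DifferentiableOn ℂ f V := hF.differentiableOn (Eventually.of_forall hd) hV
  refine (hfd.analyticAt (hV.mem_nhds hb)).eventually_eq_zero_or_eventually_ne_zero.resolve_right
    fun hz ↦ ?_
  rw [eventually_nhdsWithin_iff] at hz
  obtain ⟨s, hs, hsV⟩ := Metric.nhds_basis_closedBall.mem_iff.1 (hz.and (hV.mem_nhds hb))
  have hsub : closedBall b s ⊆ V := fun z hz ↦ (hsV hz).2
  have hsph : sphere b s ⊆ closedBall b s := sphere_subset_closedBall
  obtain ⟨w, hw, hmin⟩ := (isCompact_sphere b s).exists_isMinOn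
    (NormedSpace.sphere_nonempty.2 hs.le) ((hfd.continuousOn.mono (hsph.trans hsub)).norm)
  have hwb : w ≠ b := fun h ↦ by simp [h] at hw; exact hs.ne hw
  have hm : 0 < ‖f w‖ := norm_pos_iff.2 ((hsV (hsph hw)).1 hwb)
  have hu := Metric.tendstoUniformlyOn_iff.1
    ((tendstoLocallyUniformlyOn_iff_forall_isCompact hV).1 hF _ hsub (isCompact_closedBall b s))
    (‖f w‖ / 4) (by positivity)
  obtain ⟨i, hi⟩ := hu.exists
  have hinv : DiffContOnCl ℂ (fun z ↦ (F i z)⁻¹) (ball b s) := by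
    refine DifferentiableOn.diffContOnCl ?_
    exact ((hd i).inv (hne i)).mono (closure_ball_subset_closedBall.trans hsub)
  have hle := Complex.norm_le_of_forall_mem_frontier_norm_le isBounded_ball hinv
    (C := (3 * ‖f w‖ / 4)⁻¹) (z := b) (fun z hz ↦ ?_) (subset_closure (mem_ball_self hs))
  · have hib : ‖F i b‖ < ‖f w‖ / 4 := by
      simpa [hfb] using hi b (mem_closedBall_self hs.le)
    rw [norm_inv, inv_le_inv₀ (norm_pos_iff.2 (hne i b hb)) (by positivity)] at hle
    linarith
  · rw [frontier_ball b hs.ne'] at hz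
    have h1 : ‖f w‖ ≤ ‖f z‖ := hmin hz
    have h2 := hi z (hsph hz)
    rw [dist_eq_norm] at h2
    have h3 := norm_sub_norm_le (f z) (F i z)
    rw [norm_inv, inv_le_inv₀ (norm_pos_iff.2 (hne i z (hsub (hsph hz)))) (by positivity)]
    linarith

/-- The automorphism of the unit disc sending `c` to `0`. -/
noncomputable def blaschke (c z : ℂ) : ℂ := (z - c) / (1 - star c * z)

theorem one_sub_star_mul_ne_zero {c z : ℂ} (hc : ‖c‖ < 1) (hz : ‖z‖ < 1) :
    1 - star c * z ≠ 0 := by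
  intro h
  have h1 : ‖star c * z‖ = 1 := by rw [← sub_eq_zero.1 h, norm_one]
  rw [norm_mul, norm_star] at h1
  nlinarith [norm_nonneg c, norm_nonneg z]

theorem norm_blaschke_lt_one {c z : ℂ} (hc : ‖c‖ < 1) (hz : ‖z‖ < 1) : ‖blaschke c z‖ < 1 := by
  have h0 := one_sub_star_mul_ne_zero hc hz
  rw [blaschke, norm_div, div_lt_one (norm_pos_iff.2 h0), ← sq_lt_sq₀ (norm_nonneg _)
    (norm_nonneg _)]
  have h1 : ‖c‖ ^ 2 < 1 := by nlinarith [norm_nonneg c]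
  have h2 : ‖z‖ ^ 2 < 1 := by nlinarith [norm_nonneg z]
  have key : ‖1 - star c * z‖ ^ 2 - ‖z - c‖ ^ 2 = (1 - ‖c‖ ^ 2) * (1 - ‖z‖ ^ 2) := by
    simp only [← Complex.normSq_eq_norm_sq, Complex.normSq_apply]
    simp
    ring
  nlinarith

theorem injOn_blaschke {c : ℂ} (hc : ‖c‖ < 1) : InjOn (blaschke c) (ball 0 1) := by
  intro z hz w hw h
  rw [mem_ball_zero_iff] at hz hw
  rw [blaschke, blaschke, div_eq_div_iff (one_sub_star_mul_ne_zero hc hz)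
    (one_sub_star_mul_ne_zero hc hw)] at h
  have h0 := one_sub_star_mul_ne_zero hc hc
  refine sub_eq_zero.1 ((mul_eq_zero.1 ?_).resolve_left h0)
  linear_combination h

theorem hasDerivAt_blaschke {c z : ℂ} (hc : ‖c‖ < 1) (hz : ‖z‖ < 1) :
    HasDerivAt (blaschke c) ((1 - star c * c) / (1 - star c * z) ^ 2) z := by
  have h0 := one_sub_star_mul_ne_zero hc hz
  have := ((hasDerivAt_id z).sub_const c).div
    (((hasDerivAt_id z).const_mul (star c)).const_sub 1) h0
  refine this.congr_deriv ?_
  congr 1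
  simp
  ring

theorem hasDerivAt_of_sq_eq {U : Set ℂ} (hU : IsOpen U) {h F : ℂ → ℂ} {F' a : ℂ}
    (hc : ContinuousOn h U) (hsq : ∀ z ∈ U, h z ^ 2 = F z) (ha : a ∈ U) (hF : HasDerivAt F F' a)
    (hne : h a ≠ 0) : HasDerivAt h (F' / (2 * h a)) a := by
  rw [hasDerivAt_iff_tendsto_slope] at hF ⊢
  have hca : Tendsto h (𝓝[≠] a) (𝓝 (h a)) :=
    (hc.continuousAt (hU.mem_nhds ha)).tendsto.mono_left nhdsWithin_le_nhds
  have hsum : Tendsto (fun z ↦ h z + h a) (𝓝[≠] a) (𝓝 (2 * h a)) := by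
    rw [two_mul]; exact hca.add_const _
  have h2 : 2 * h a ≠ 0 := mul_ne_zero two_ne_zero hne
  refine (hF.div hsum h2).congr' ?_
  filter_upwards [hsum.eventually_ne h2, mem_nhdsWithin_of_mem_nhds (hU.mem_nhds ha)] with z hz hzU
  rw [Pi.div_apply, slope_def_field, slope_def_field, ← hsq z hzU, ← hsq a ha, div_div,
    mul_comm (z - a), ← div_div]
  congr 1
  field_simp
  ring

/-- Holomorphic embeddings of `U` into the unit disc that fix the origin. -/
structure IsDiscEmbedding (U : Set ℂ) (g : ℂ → ℂ) : Prop where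
  differentiableOn : DifferentiableOn ℂ g U
  injOn : InjOn g U
  deriv_ne_zero : ∀ z ∈ U, deriv g z ≠ 0
  mapsTo : MapsTo g U (ball 0 1)
  map_zero : g 0 = 0

theorem map_nhds_of_deriv_ne_zero {U : Set ℂ} {g : ℂ → ℂ} (hU : IsOpen U)
    (hd : DifferentiableOn ℂ g U) (hne : ∀ z ∈ U, deriv g z ≠ 0) {z : ℂ} (hz : z ∈ U) :
    map g (𝓝 z) = 𝓝 (g z) :=
  (hd.analyticAt (hU.mem_nhds hz)).hasStrictDerivAt.map_nhds_eq (hne z hz)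

theorem exists_isDiscEmbedding_of_isBounded {U : Set ℂ}
    (hb : Bornology.IsBounded U) : ∃ g, IsDiscEmbedding U g := by
  obtain ⟨R, hR, hRU⟩ := hb.subset_ball_lt 0 0
  have hRc : (R : ℂ) ≠ 0 := by exact_mod_cast hR.ne'
  refine ⟨fun z ↦ z / R, (differentiable_id.div_const _).differentiableOn,
    fun z _ w _ h ↦ by simpa [div_left_inj' hRc] using h, fun z _ ↦ ?_, fun z hz ↦ ?_, by simp⟩
  · simp [hRc]
  · have := hRU hz
    rw [mem_ball_zero_iff] at this ⊢
    rwa [norm_div, Complex.norm_real, Real.norm_of_nonneg hR.le, div_lt_one hR]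

theorem IsDiscEmbedding.exists_extremal {U : Set ℂ} (hU : IsOpen U) (hc : IsPreconnected U)
    (h0 : (0 : ℂ) ∈ U) (hex : ∃ g, IsDiscEmbedding U g) :
    ∃ g, IsDiscEmbedding U g ∧ ∀ f, IsDiscEmbedding U f → ‖deriv f 0‖ ≤ ‖deriv g 0‖ := by
  set S : Set ℝ := (fun g ↦ ‖deriv g 0‖) '' {g | IsDiscEmbedding U g} with hS
  obtain ⟨g₀, hg₀⟩ := hex
  have hSne : S.Nonempty := ⟨_, g₀, hg₀, rfl⟩
  have hSb : BddAbove S := by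
    obtain ⟨s, hs, hsU⟩ := Metric.nhds_basis_closedBall.mem_iff.1 (hU.mem_nhds h0)
    refine ⟨1 / s, ?_⟩
    rintro _ ⟨g, hg, rfl⟩
    refine Complex.norm_deriv_le_of_forall_mem_sphere_norm_le hs ?_ fun z hz ↦ ?_
    · exact (hg.differentiableOn.mono (closure_ball_subset_closedBall.trans hsU)).diffContOnCl
    · exact (mem_ball_zero_iff.1 (hg.mapsTo (hsU (sphere_subset_closedBall hz)))).le
  obtain ⟨u, -, hu, huS⟩ := exists_seq_tendsto_sSup hSne hSb
  choose G hG hGu using huS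
  set 𝒰 : Ultrafilter ℕ := hyperfilter ℕ
  have h𝒰 : (𝒰 : Filter ℕ) ≤ atTop := Nat.hyperfilter_le_atTop
  have hGd : ∀ i, DifferentiableOn ℂ (G i) U := fun i ↦ (hG i).differentiableOn
  obtain ⟨g, hg⟩ := exists_tendstoLocallyUniformlyOn_of_mapsTo_closedBall 𝒰 hU hGd
    fun i ↦ (hG i).mapsTo.mono_right ball_subset_closedBall
  have hgd : DifferentiableOn ℂ g U := hg.differentiableOn (Eventually.of_forall hGd) hU
  have hg' : TendstoLocallyUniformlyOn (fun i ↦ deriv (G i)) (deriv g) 𝒰 U :=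
    hg.deriv (Eventually.of_forall hGd) hU
  have hgsup : ‖deriv g 0‖ = sSup S := by
    refine tendsto_nhds_unique (hg'.tendsto_at h0).norm ((hu.mono_left h𝒰).congr fun i ↦ ?_)
    exact (hGu i).symm
  have hle : ∀ f, IsDiscEmbedding U f → ‖deriv f 0‖ ≤ ‖deriv g 0‖ := fun f hf ↦
    hgsup ▸ le_csSup hSb ⟨f, hf, rfl⟩
  have hne0 : deriv g 0 ≠ 0 := by
    rw [← norm_pos_iff]
    exact (norm_pos_iff.2 (hg₀.deriv_ne_zero 0 h0)).trans_le (hle g₀ hg₀)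
  have hderiv : ∀ z ∈ U, deriv g z ≠ 0 := by
    intro z hz hgz
    have := hg'.eventually_eq_zero_of_ne_zero hU (fun i ↦ (hGd i).deriv hU)
      (fun i ↦ (hG i).deriv_ne_zero) hz hgz
    exact hne0 (((hgd.deriv hU).analyticOnNhd hU).eqOn_of_preconnected_of_eventuallyEq
      (g := fun _ ↦ 0) analyticOnNhd_const hc hz this h0)
  have hinj : InjOn g U := by
    intro a ha b hb hab
    by_contra hne
    have hV : IsOpen (U \ {a}) := hU.sdiff isClosed_singleton
    have hsub : U \ {a} ⊆ U := sdiff_subset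
    have hlu : TendstoLocallyUniformlyOn (fun i z ↦ G i z - G i a) (fun z ↦ g z - g a) 𝒰
        (U \ {a}) := by
      refine (hg.mono hsub).sub ?_
      exact ((hg.tendsto_at ha).tendstoUniformlyOn_const _).tendstoLocallyUniformlyOn
    have := hlu.eventually_eq_zero_of_ne_zero hV (fun i ↦ ((hGd i).mono hsub).sub_const _)
      (fun i z hz h ↦ hz.2 ((hG i).injOn hz.1 ha (sub_eq_zero.1 h))) ⟨hb, fun h ↦ hne h.symm⟩
      (by simp [hab])
    refine hderiv b hb ?_
    have hev : g =ᶠ[𝓝 b] fun _ ↦ g a := this.mono fun z hz ↦ sub_eq_zero.1 hz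
    rw [hev.deriv_eq, deriv_const]
  refine ⟨g, ⟨hgd, hinj, hderiv, fun z hz ↦ ?_, ?_⟩, hle⟩
  · rw [← interior_closedBall (0 : ℂ) one_ne_zero, mem_interior_iff_mem_nhds,
      ← map_nhds_of_deriv_ne_zero hU hgd hderiv hz, mem_map]
    filter_upwards [hU.mem_nhds hz] with w hw
    rw [mem_preimage, mem_closedBall_zero_iff]
    exact le_of_tendsto (hg.tendsto_at hw).norm (Eventually.of_forall fun i ↦
      (mem_ball_zero_iff.1 ((hG i).mapsTo hw)).le)
  · refine tendsto_nhds_unique (hg.tendsto_at h0) ?_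
    simp [(hG _).map_zero]

theorem IsDiscEmbedding.surjOn_of_extremal {U : Set ℂ} (hU : IsOpen U) (hsc : IsSimplyConnected U)
    (h0 : (0 : ℂ) ∈ U) {f : ℂ → ℂ} (hf : IsDiscEmbedding U f)
    (hmax : ∀ g, IsDiscEmbedding U g → ‖deriv g 0‖ ≤ ‖deriv f 0‖) :
    SurjOn f U (ball 0 1) := by
  intro w hw
  by_contra hwf
  rw [mem_ball_zero_iff] at hw
  have hfU : ∀ z ∈ U, ‖f z‖ < 1 := fun z hz ↦ mem_ball_zero_iff.1 (hf.mapsTo hz)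
  have hw0 : w ≠ 0 := fun h ↦ hwf ⟨0, h0, by rw [hf.map_zero, h]⟩
  set F : ℂ → ℂ := fun z ↦ blaschke w (f z) with hFdef
  have hF' : ∀ z ∈ U, HasDerivAt F
      ((1 - star w * w) / (1 - star w * f z) ^ 2 * deriv f z) z := fun z hz ↦
    (hasDerivAt_blaschke hw (hfU z hz)).comp z
      (hf.differentiableOn.differentiableAt (hU.mem_nhds hz)).hasDerivAt
  have hFne : ∀ z ∈ U, F z ≠ 0 := by
    intro z hz h
    rcases div_eq_zero_iff.1 h with h | h
    · exact hwf ⟨z, hz, sub_eq_zero.1 h⟩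
    · exact one_sub_star_mul_ne_zero hw (hfU z hz) h
  obtain ⟨h, hhc, hh⟩ := Complex.exists_continuousOn_pow_eq hsc hU
    (fun z hz ↦ (hF' z hz).continuousAt.continuousWithinAt)
    (fun ⟨z, hz, h⟩ ↦ hFne z hz h) two_ne_zero
  have hhne : ∀ z ∈ U, h z ≠ 0 := fun z hz e ↦ hFne z hz (by rw [← hh z, e]; simp)
  have hh' := fun z hz ↦ hasDerivAt_of_sq_eq hU hhc (fun z _ ↦ hh z) hz (hF' z hz) (hhne z hz)
  have hhlt : ∀ z ∈ U, ‖h z‖ < 1 := by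
    intro z hz
    rw [← pow_lt_one_iff_of_nonneg (norm_nonneg _) two_ne_zero, ← norm_pow, hh]
    exact norm_blaschke_lt_one hw (hfU z hz)
  set c := h 0 with hcdef
  have hc : ‖c‖ < 1 := hhlt 0 h0
  have hcw : c ^ 2 = -w := by rw [hcdef, hh, hFdef]; simp [blaschke, hf.map_zero]
  have hcn : ‖c‖ ^ 2 = ‖w‖ := by rw [← norm_pow, hcw, norm_neg]
  have hg' := fun z hz ↦ (hasDerivAt_blaschke hc (hhlt z hz)).comp z (hh' z hz)
  have h1 : ∀ {b : ℂ}, ‖b‖ < 1 → (1 - star b * b) ≠ 0 := fun hb ↦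
    one_sub_star_mul_ne_zero hb hb
  have hle := hmax (fun z ↦ blaschke c (h z)) ⟨fun z hz ↦
    (hg' z hz).differentiableAt.differentiableWithinAt, fun z hz z' hz' e ↦ ?_, fun z hz ↦ ?_,
    fun z hz ↦ mem_ball_zero_iff.2 (norm_blaschke_lt_one hc (hhlt z hz)),
    by simp [blaschke, ← hcdef]⟩
  · have hd := (hg' 0 h0).deriv
    have hstar : ∀ b : ℂ, 1 - star b * b = ((1 - ‖b‖ ^ 2 : ℝ) : ℂ) := by
      intro b
      have := Complex.conj_mul' b
      push_cast
      rw [← this]; rfl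
    have hfpos : 0 < ‖deriv f 0‖ := norm_pos_iff.2 (hf.deriv_ne_zero 0 h0)
    have hc0 : 0 < ‖c‖ := norm_pos_iff.2 (hhne 0 h0)
    have e : ‖deriv (fun z ↦ blaschke c (h z)) 0‖ =
        (1 + ‖c‖ ^ 2) / (2 * ‖c‖) * ‖deriv f 0‖ := by
      change deriv (fun z ↦ blaschke c (h z)) 0 = _ at hd
      rw [hd, hf.map_zero, ← hcdef, hstar, hstar, ← hcn]
      have p1 : 0 < 1 - ‖c‖ ^ 2 := by nlinarith
      have p2 : 0 < 1 - (‖c‖ ^ 2) ^ 2 := by nlinarith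
      simp only [norm_mul, norm_div, norm_pow, Complex.norm_real, Real.norm_of_nonneg p1.le,
        Real.norm_of_nonneg p2.le, mul_zero, sub_zero, norm_one, Complex.norm_ofNat]
      field_simp
      ring
    rw [e] at hle
    have : 1 < (1 + ‖c‖ ^ 2) / (2 * ‖c‖) := by
      rw [lt_div_iff₀ (by positivity)]
      nlinarith [sq_pos_of_pos (sub_pos.2 hc)]
    nlinarith
  · have e1 : h z = h z' := injOn_blaschke hc (mem_ball_zero_iff.2 (hhlt z hz))
      (mem_ball_zero_iff.2 (hhlt z' hz')) e
    have e2 : F z = F z' := by rw [← hh, ← hh, e1]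
    exact hf.injOn hz hz' (injOn_blaschke hw (hf.mapsTo hz) (hf.mapsTo hz') e2)
  · have hd := (hg' z hz).deriv
    change deriv (fun z ↦ blaschke c (h z)) z = _ at hd
    rw [hd]
    refine mul_ne_zero (div_ne_zero (h1 hc) (pow_ne_zero _ (one_sub_star_mul_ne_zero hc
      (hhlt z hz)))) (div_ne_zero (mul_ne_zero (div_ne_zero (h1 hw) (pow_ne_zero _
      (one_sub_star_mul_ne_zero hw (hfU z hz)))) (hf.deriv_ne_zero z hz)) ?_)
    exact mul_ne_zero two_ne_zero (hhne z hz)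

/-- A Riemann map of the disc onto `U` fixing the origin, with its continuous inverse. -/
structure IsRiemannMap (U : Set ℂ) (f g : ℂ → ℂ) : Prop where
  differentiableOn : DifferentiableOn ℂ f (ball 0 1)
  continuousOn : ContinuousOn g U
  mapsTo : MapsTo f (ball 0 1) U
  mapsTo_inv : MapsTo g U (ball 0 1)
  leftInvOn : LeftInvOn g f (ball 0 1)
  rightInvOn : LeftInvOn f g U
  map_zero : f 0 = 0

/-- The Riemann mapping theorem for bounded domains. -/
theorem exists_isRiemannMap {U : Set ℂ} (hU : IsOpen U) (hsc : IsSimplyConnected U)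
    (hc : IsPreconnected U) (hb : Bornology.IsBounded U) (h0 : (0 : ℂ) ∈ U) :
    ∃ f g, IsRiemannMap U f g := by
  obtain ⟨g, hg, hmax⟩ := IsDiscEmbedding.exists_extremal hU hc h0
    (exists_isDiscEmbedding_of_isBounded hb)
  have hsurj := hg.surjOn_of_extremal hU hsc h0 hmax
  have hgf : LeftInvOn g (Function.invFunOn g U) (ball 0 1) := hsurj.rightInvOn_invFunOn
  have hfg : LeftInvOn (Function.invFunOn g U) g U := hg.injOn.leftInvOn_invFunOn
  have hfU : MapsTo (Function.invFunOn g U) (ball 0 1) U := hsurj.mapsTo_invFunOn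
  refine ⟨Function.invFunOn g U, g, fun w hw ↦ ?_, hg.differentiableOn.continuousOn, hfU,
    hg.mapsTo, hgf, hfg, ?_⟩
  · have hcont : ContinuousAt (Function.invFunOn g U) w := by
      have hz := hfU hw
      rw [ContinuousAt]
      nth_rewrite 1 [← hgf hw]
      rw [← map_nhds_of_deriv_ne_zero hU hg.differentiableOn hg.deriv_ne_zero hz, tendsto_map'_iff]
      refine tendsto_id.congr' ?_
      filter_upwards [hU.mem_nhds hz] with z hz
      exact (hfg hz).symm
    refine (HasDerivAt.of_local_left_inverse hcont
      (hg.differentiableOn.differentiableAt (hU.mem_nhds (hfU hw))).hasDerivAt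
      (hg.deriv_ne_zero _ (hfU hw)) ?_).differentiableAt.differentiableWithinAt
    filter_upwards [isOpen_ball.mem_nhds hw] with z hz using hgf hz
  · have := hfg h0
    rwa [hg.map_zero] at this

theorem setLIntegral_enorm_deriv_sq_eq_volume_image {f : ℂ → ℂ} {V : Set ℂ} (hV : IsOpen V)
    (hd : DifferentiableOn ℂ f V) (hinj : InjOn f V) :
    ∫⁻ z in V, ‖deriv f z‖ₑ ^ 2 = volume (f '' V) := by
  have hderiv : ∀ z ∈ V, HasFDerivWithinAt f ((ContinuousLinearMap.toSpanSingleton ℂ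
      (deriv f z)).restrictScalars ℝ) V z := fun z hz ↦
    ((hd.differentiableAt (hV.mem_nhds hz)).hasDerivAt.hasFDerivAt.restrictScalars
      ℝ).hasFDerivWithinAt
  rw [← lintegral_abs_det_fderiv_eq_addHaar_image volume hV.measurableSet hderiv hinj]
  refine lintegral_congr fun z ↦ ?_
  have : ((ContinuousLinearMap.toSpanSingleton ℂ (deriv f z)).restrictScalars ℝ).det =
      ‖deriv f z‖ ^ 2 := by
    rw [ContinuousLinearMap.det, ContinuousLinearMap.coe_restrictScalars,
      LinearMap.det_restrictScalars, LinearMap.det_ring, Algebra.norm_complex_apply,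
      Complex.normSq_eq_norm_sq]
    simp
  rw [this, abs_of_nonneg (by positivity), ENNReal.ofReal_pow (norm_nonneg _), ofReal_norm]

theorem neg_one_add_mem_ball_iff {r θ : ℝ} (hr : 0 < r) :
    -1 + r * Complex.exp (θ * Complex.I) ∈ ball (0 : ℂ) 1 ↔ r / 2 < Real.cos θ := by
  have h : ‖-1 + r * Complex.exp (θ * Complex.I)‖ ^ 2 = 1 - 2 * r * Real.cos θ + r ^ 2 := by
    rw [← Complex.normSq_eq_norm_sq, Complex.normSq_apply, Complex.exp_mul_I,
      ← Complex.ofReal_cos, ← Complex.ofReal_sin]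
    simp [-Complex.ofReal_cos, -Complex.ofReal_sin]
    nlinarith [Real.sin_sq_add_cos_sq θ]
  rw [mem_ball_zero_iff, ← pow_lt_one_iff_of_nonneg (norm_nonneg _) two_ne_zero, h]
  constructor <;> intro h' <;> nlinarith

theorem exists_angle_of_mem_sphere {r : ℝ} (hr : 0 < r) {z : ℂ} (hz : z ∈ ball (0 : ℂ) 1)
    (hzr : z ∈ sphere (-1 : ℂ) r) :
    ∃ θ ∈ Ioo (-(Real.pi / 2)) (Real.pi / 2), -1 + r * Complex.exp (θ * Complex.I) = z := by
  have hn : ‖z + 1‖ = r := by simpa [dist_eq_norm] using hzr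
  have he : -1 + r * Complex.exp ((z + 1).arg * Complex.I) = z := by
    rw [← hn, Complex.norm_mul_exp_arg_mul_I]; ring
  refine ⟨(z + 1).arg, abs_lt.1 (Complex.abs_arg_lt_pi_div_two_iff.2 (Or.inl ?_)), he⟩
  rw [← he] at hz
  have hc := (neg_one_add_mem_ball_iff hr).1 hz
  have h1 : z + 1 ≠ 0 := by rw [← norm_pos_iff, hn]; exact hr
  rw [Complex.cos_arg h1, hn, lt_div_iff₀ hr] at hc
  nlinarith

theorem ofReal_dist_le_lintegral_arc {f : ℂ → ℂ} (hd : DifferentiableOn ℂ f (ball 0 1))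
    {r a b : ℝ} (hr : 0 < r) (hab : a ≤ b)
    (harc : ∀ θ ∈ Icc a b, -1 + r * Complex.exp (θ * Complex.I) ∈ ball (0 : ℂ) 1) :
    ‖f (-1 + r * Complex.exp (b * Complex.I)) - f (-1 + r * Complex.exp (a * Complex.I))‖ₑ ≤
      ∫⁻ θ in Icc a b, ENNReal.ofReal r * ‖deriv f (-1 + r * Complex.exp (θ * Complex.I))‖ₑ := by
  set p : ℝ → ℂ := fun θ ↦ -1 + r * Complex.exp (θ * Complex.I) with hp
  have hpd : ∀ θ : ℝ, HasDerivAt p (r * (Complex.exp (θ * Complex.I) * Complex.I)) θ := by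
    intro θ
    have h1 : HasDerivAt (fun θ : ℂ ↦ θ * Complex.I) Complex.I θ := by
      simpa using (hasDerivAt_id (θ : ℂ)).mul_const Complex.I
    exact ((h1.cexp.const_mul (r : ℂ)).const_add (-1)).comp_ofReal
  have hpc : ContDiff ℝ 1 p := by
    have : ContDiff ℝ 1 (fun θ : ℝ ↦ (θ : ℂ)) := Complex.ofRealCLM.contDiff
    exact contDiff_const.add (contDiff_const.mul (this.mul contDiff_const).cexp)
  have hc : ContDiffOn ℝ 1 (f ∘ p) (Icc a b) :=
    ((hd.contDiffOn isOpen_ball).restrict_scalars ℝ).comp hpc.contDiffOn harc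
  refine (enorm_sub_le_lintegral_deriv_of_contDiffOn_Icc hc hab).trans_eq ?_
  refine setLIntegral_congr_fun measurableSet_Icc fun θ hθ ↦ ?_
  have hfd := (hd.differentiableAt (isOpen_ball.mem_nhds (harc θ hθ))).hasDerivAt
  have := (hfd.scomp θ (hpd θ)).deriv
  change ‖deriv (f ∘ p) θ‖ₑ = _
  rw [this, smul_eq_mul, ← ofReal_norm, ← ofReal_norm, ← ENNReal.ofReal_mul hr.le,
    norm_mul, norm_mul, norm_mul, Complex.norm_exp_ofReal_mul_I, Complex.norm_real, Real.norm_of_nonneg hr.le, Complex.norm_I]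
  congr 1
  ring

/-- The length-area estimate on a circular arc around `-1`: by the Cauchy-Schwarz inequality,
large oscillation of `f` on the arc forces a large contribution to the area. -/
theorem ofReal_le_lintegral_of_lt_dist {f : ℂ → ℂ} (hd : DifferentiableOn ℂ f (ball 0 1))
    {r η : ℝ} (hr : 0 < r) (hη : 0 < η) {z w : ℂ} (hz : z ∈ ball (0 : ℂ) 1)
    (hzr : z ∈ sphere (-1 : ℂ) r) (hw : w ∈ ball (0 : ℂ) 1) (hwr : w ∈ sphere (-1 : ℂ) r)
    (hzw : η < dist (f z) (f w)) :
    ENNReal.ofReal (η ^ 2 / (2 * Real.pi) * r⁻¹) ≤ ∫⁻ θ in Ioo (-Real.pi) Real.pi,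
      ENNReal.ofReal r * (ball (0 : ℂ) 1).indicator (fun z ↦ ‖deriv f z‖ₑ ^ 2)
        (-1 + r * Complex.exp (θ * Complex.I)) := by
  obtain ⟨a, ha, rfl⟩ := exists_angle_of_mem_sphere hr hz hzr
  obtain ⟨b, hb, rfl⟩ := exists_angle_of_mem_sphere hr hw hwr
  wlog hab : a ≤ b generalizing a b
  · exact this b hb hw hwr a ha hz hzr (by rwa [dist_comm]) (le_of_not_ge hab)
  have hpi := Real.pi_pos
  have harc : ∀ θ ∈ Icc a b, -1 + r * Complex.exp (θ * Complex.I) ∈ ball (0 : ℂ) 1 := by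
    intro θ hθ
    rw [neg_one_add_mem_ball_iff hr] at hz hw ⊢
    exact (lt_min hz hw).trans_le (strictConcaveOn_cos_Icc.concaveOn.min_le_of_mem_Icc
      (Ioo_subset_Icc_self ha) (Ioo_subset_Icc_self hb) hθ)
  set p : ℝ → ℂ := fun θ ↦ -1 + r * Complex.exp (θ * Complex.I) with hp
  set φ : ℂ → ℝ≥0∞ := (ball (0 : ℂ) 1).indicator (fun z ↦ ‖deriv f z‖ₑ ^ 2) with hφ
  set I : ℝ≥0∞ := ∫⁻ θ in Ioo (-Real.pi) Real.pi, ENNReal.ofReal r * φ (p θ) with hI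
  have hpm : Measurable p := by fun_prop
  have hφm : Measurable φ :=
    ((measurable_deriv f).enorm.pow_const 2).indicator measurableSet_ball
  have hm : Measurable fun θ ↦ φ (p θ) := hφm.comp hpm
  have hIcc : Icc a b ⊆ Ioo (-Real.pi) Real.pi := fun θ hθ ↦
    ⟨by linarith [ha.1, hθ.1], by linarith [hb.2, hθ.2]⟩
  have hmain : ENNReal.ofReal η ≤ ENNReal.ofReal (η / 2) +
      ENNReal.ofReal (r * Real.pi / η) * I := by
    calc ENNReal.ofReal η ≤ ‖f (p b) - f (p a)‖ₑ := by
          rw [← ofReal_norm, ← dist_eq_norm, dist_comm]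
          exact ENNReal.ofReal_le_ofReal hzw.le
      _ ≤ ∫⁻ θ in Icc a b, ENNReal.ofReal r * ‖deriv f (p θ)‖ₑ :=
          ofReal_dist_le_lintegral_arc hd hr hab harc
      _ ≤ ∫⁻ θ in Icc a b, (ENNReal.ofReal (η / (4 * Real.pi)) +
            ENNReal.ofReal (r * Real.pi / η) * (ENNReal.ofReal r * φ (p θ))) := by
          refine setLIntegral_mono' measurableSet_Icc fun θ hθ ↦ ?_
          rw [hφ, indicator_of_mem (harc θ hθ), ← ofReal_norm, ← ENNReal.ofReal_mul hr.le,
            ← ENNReal.ofReal_pow (norm_nonneg _), ← ENNReal.ofReal_mul hr.le,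
            ← ENNReal.ofReal_mul (by positivity), ← ENNReal.ofReal_add (by positivity)
            (by positivity)]
          refine ENNReal.ofReal_le_ofReal ?_
          set x := ‖deriv f (p θ)‖
          have h0 : 0 ≤ Real.pi / η * (r * x - η / (2 * Real.pi)) ^ 2 := by positivity
          have h1 : Real.pi / η * (r * x - η / (2 * Real.pi)) ^ 2 =
              η / (4 * Real.pi) + r * Real.pi / η * (r * x ^ 2) - r * x := by
            field_simp
            ring
          linarith
      _ ≤ ∫⁻ θ in Ioo (-Real.pi) Real.pi, (ENNReal.ofReal (η / (4 * Real.pi)) +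
            ENNReal.ofReal (r * Real.pi / η) * (ENNReal.ofReal r * φ (p θ))) :=
          lintegral_mono_set hIcc
      _ = ENNReal.ofReal (η / 2) + ENNReal.ofReal (r * Real.pi / η) * I := by
          rw [lintegral_add_left measurable_const, setLIntegral_const, Real.volume_Ioo,
            lintegral_const_mul _ (hm.const_mul _),
            ← ENNReal.ofReal_mul (by positivity)]
          congr 2
          field_simp
          ring
  by_cases hItop : I = ∞
  · rw [hItop]; exact le_top
  rw [← ENNReal.ofReal_toReal hItop] at hmain ⊢
  have hI0 : 0 ≤ I.toReal := ENNReal.toReal_nonneg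
  rw [← ENNReal.ofReal_mul (by positivity), ← ENNReal.ofReal_add (by positivity) (by positivity),
    ENNReal.ofReal_le_ofReal_iff (by positivity)] at hmain
  refine ENNReal.ofReal_le_ofReal ?_
  have h2 : η / 2 ≤ r * Real.pi / η * I.toReal := by linarith
  rw [div_mul_eq_mul_div, le_div_iff₀ hη] at h2
  rw [← div_eq_mul_inv, div_div, div_le_iff₀ (by positivity)]
  linarith

theorem lintegral_ofReal_const_mul_inv {c : ℝ} (hc : 0 < c) :
    ∫⁻ r in Ioo (0 : ℝ) 1, ENNReal.ofReal (c * r⁻¹) = ∞ := by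
  by_contra h
  have h1 : IntegrableOn (fun r : ℝ ↦ c * r⁻¹) (Ioo 0 1) := by
    refine ⟨by fun_prop, ?_⟩
    rw [hasFiniteIntegral_iff_ofReal]
    · exact lt_top_iff_ne_top.2 h
    · filter_upwards [ae_restrict_mem measurableSet_Ioo] with r hr
      have := hr.1
      exact (by positivity : 0 ≤ c * r⁻¹)
  have h2 : IntervalIntegrable (fun r : ℝ ↦ r⁻¹) volume 0 1 := by
    rw [intervalIntegrable_iff_integrableOn_Ioo_of_le zero_le_one]
    refine (h1.const_mul c⁻¹).congr (Eventually.of_forall fun r ↦ ?_)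
    field_simp
  simp [intervalIntegrable_inv_iff] at h2

/-- Wolff's lemma: an injective holomorphic function on the disc whose image has finite area
oscillates little along some circular arc around `-1`. -/
theorem exists_arc_dist_le {f : ℂ → ℂ} (hd : DifferentiableOn ℂ f (ball 0 1))
    (hinj : InjOn f (ball 0 1)) (hvol : volume (f '' ball 0 1) ≠ ∞) {η : ℝ} (hη : 0 < η) :
    ∃ r ∈ Ioo (0 : ℝ) 1, ∀ z ∈ ball (0 : ℂ) 1 ∩ sphere (-1) r,
      ∀ w ∈ ball (0 : ℂ) 1 ∩ sphere (-1) r, dist (f z) (f w) ≤ η := by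
  by_contra! hcon
  set φ : ℂ → ℝ≥0∞ := (ball (0 : ℂ) 1).indicator (fun z ↦ ‖deriv f z‖ₑ ^ 2) with hφ
  have hφm : Measurable φ :=
    ((measurable_deriv f).enorm.pow_const 2).indicator measurableSet_ball
  have hc : 0 < η ^ 2 / (2 * Real.pi) := by have := Real.pi_pos; positivity
  refine hvol (top_unique ?_)
  set ψ : ℝ × ℝ → ℝ≥0∞ := fun p ↦ ENNReal.ofReal p.1 *
    φ (-1 + p.1 * Complex.exp (p.2 * Complex.I)) with hψ
  have hψm : Measurable ψ := by
    refine (ENNReal.measurable_ofReal.comp measurable_fst).mul (hφm.comp ?_)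
    fun_prop
  calc (∞ : ℝ≥0∞) = ∫⁻ r in Ioo (0 : ℝ) 1, ENNReal.ofReal (η ^ 2 / (2 * Real.pi) * r⁻¹) :=
        (lintegral_ofReal_const_mul_inv hc).symm
    _ ≤ ∫⁻ r in Ioo (0 : ℝ) 1, ∫⁻ θ in Ioo (-Real.pi) Real.pi, ψ (r, θ) := by
        refine setLIntegral_mono' measurableSet_Ioo fun r hr ↦ ?_
        obtain ⟨z, hz, w, hw, hzw⟩ := hcon r hr
        exact ofReal_le_lintegral_of_lt_dist hd hr.1 hη hz.1 hz.2 hw.1 hw.2 hzw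
    _ ≤ ∫⁻ r in Ioi (0 : ℝ), ∫⁻ θ in Ioo (-Real.pi) Real.pi, ψ (r, θ) :=
        lintegral_mono_set Ioo_subset_Ioi_self
    _ = ∫⁻ p in polarCoord.target, ψ p := by
        rw [polarCoord_target, Measure.volume_eq_prod, ← Measure.prod_restrict,
          lintegral_prod _ hψm.aemeasurable]
    _ = ∫⁻ z, φ (-1 + z) := by
        rw [← Complex.lintegral_comp_polarCoord_symm]
        refine lintegral_congr fun p ↦ ?_
        simp only [hψ]
        rw [Complex.polarCoord_symm_apply, smul_eq_mul, Complex.exp_mul_I,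
          Complex.ofReal_cos, Complex.ofReal_sin]
    _ = ∫⁻ z, φ z := lintegral_add_left_eq_self φ (-1)
    _ = volume (f '' ball 0 1) := by
        rw [hφ, lintegral_indicator measurableSet_ball,
          setLIntegral_enorm_deriv_sq_eq_volume_image isOpen_ball hd hinj]

/-- The circular arc of radius `r < 1` around `-1` inside the disc accumulates at the unit
circle. -/
theorem exists_mem_sphere_mem_closure_arc {r : ℝ} (hr : r ∈ Ioo (0 : ℝ) 1) :
    ∃ w ∈ sphere (0 : ℂ) 1, w ∈ closure (ball (0 : ℂ) 1 ∩ sphere (-1) r) := by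
  set p : ℝ → ℂ := fun θ ↦ -1 + r * Complex.exp (θ * Complex.I) with hp
  have hpc : Continuous p := by fun_prop
  set α := Real.arccos (r / 2) with hα
  have hcosα : Real.cos α = r / 2 :=
    Real.cos_arccos (by linarith [hr.1]) (by linarith [hr.2])
  have hα0 : 0 < α := Real.arccos_pos.2 (by linarith [hr.2])
  have hmem : ∀ θ ∈ Ico 0 α, p θ ∈ ball (0 : ℂ) 1 ∩ sphere (-1) r := fun θ hθ ↦
    ⟨(neg_one_add_mem_ball_iff hr.1).2
      (hcosα ▸ Real.cos_lt_cos_of_nonneg_of_le_pi hθ.1 (Real.arccos_le_pi _) hθ.2),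
      by simp [hp, Complex.norm_exp_ofReal_mul_I, abs_of_pos hr.1]⟩
  have hcl : p α ∈ closure (ball (0 : ℂ) 1 ∩ sphere (-1) r) :=
    map_mem_closure hpc (by rw [closure_Ico hα0.ne]; exact right_mem_Icc.2 hα0.le) hmem
  refine ⟨p α, ?_, hcl⟩
  have h1 : p α ∉ ball (0 : ℂ) 1 := fun h ↦ by
    rw [neg_one_add_mem_ball_iff hr.1, hcosα] at h
    exact h.false
  have h2 := closure_ball_subset_closedBall (closure_mono inter_subset_left hcl)
  rw [mem_ball_zero_iff] at h1
  rw [mem_closedBall_zero_iff] at h2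
  exact mem_sphere_zero_iff_norm.2 (le_antisymm h2 (not_lt.1 h1))

/-- Every subset disconnected from `0` by a small set touching the boundary of `U`
is small. -/
def SmallCutsProperty (U : Set ℂ) : Prop :=
  ∀ ε : ℝ, 0 < ε → ∃ δ : ℝ, 0 < δ ∧ ∀ A Y : Set ℂ, A ⊆ U →
    ediam Y ≤ ENNReal.ofReal δ → (Y ∩ frontier U).Nonempty → (0 : ℂ) ∉ Y →
    (∀ a ∈ A, a ∉ Y → a ∉ connectedComponentIn (U \ Y) 0) →
    ediam A ≤ ENNReal.ofReal ε

namespace IsRiemannMap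

variable {U : Set ℂ} {f g : ℂ → ℂ}

theorem comp_rotation (h : IsRiemannMap U f g) {c : ℂ} (hc : ‖c‖ = 1) :
    IsRiemannMap U (fun z ↦ f (c * z)) (fun z ↦ c⁻¹ * g z) := by
  have hc0 : c ≠ 0 := by rw [← norm_pos_iff, hc]; exact one_pos
  have hm : MapsTo (fun z ↦ c * z) (ball 0 1) (ball 0 1) := fun z hz ↦ by
    simpa [hc] using hz
  refine ⟨h.differentiableOn.comp (by fun_prop) hm, continuousOn_const.mul h.continuousOn,
    h.mapsTo.comp hm, fun z hz ↦ ?_, fun z hz ↦ ?_, fun z hz ↦ ?_, by simpa using h.map_zero⟩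
  · simpa [hc] using h.mapsTo_inv hz
  · rw [h.leftInvOn (hm hz), inv_mul_cancel_left₀ hc0]
  · rw [mul_inv_cancel_left₀ hc0, h.rightInvOn hz]

theorem closure_image_arc_inter_frontier_nonempty (h : IsRiemannMap U f g)
    (hb : Bornology.IsBounded U) {r : ℝ} (hr : r ∈ Ioo (0 : ℝ) 1) :
    (closure (f '' (ball (0 : ℂ) 1 ∩ sphere (-1) r)) ∩ frontier U).Nonempty := by
  set C := ball (0 : ℂ) 1 ∩ sphere (-1) r with hC
  by_contra hne
  have hCU : f '' C ⊆ U := by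
    rintro _ ⟨z, hz, rfl⟩
    exact h.mapsTo hz.1
  have hYU : closure (f '' C) ⊆ U := fun y hy ↦ by
    by_contra hyU
    exact hne ⟨y, hy, closure_mono hCU hy, fun hi ↦ hyU (interior_subset hi)⟩
  have hK : IsCompact (closure (f '' C)) := (hb.subset hCU).isCompact_closure
  have hgK : IsCompact (g '' closure (f '' C)) := hK.image_of_continuousOn (h.continuousOn.mono hYU)
  have hCg : C ⊆ g '' closure (f '' C) := fun z hz ↦
    ⟨f z, subset_closure ⟨z, hz, rfl⟩, h.leftInvOn hz.1⟩
  obtain ⟨w, hw, hwC⟩ := exists_mem_sphere_mem_closure_arc hr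
  obtain ⟨y, hy, rfl⟩ := closure_minimal hCg hgK.isClosed hwC
  have h1 := h.mapsTo_inv (hYU hy)
  rw [mem_ball_zero_iff] at h1
  rw [mem_sphere_zero_iff_norm] at hw
  exact h1.ne hw

/-- The image of the arc of radius `r` around `-1` disconnects the image of the cap cut off by it
from the origin. -/
theorem notMem_connectedComponentIn (h : IsRiemannMap U f g) {r : ℝ} (hr : r ∈ Ioo (0 : ℝ) 1)
    {Y : Set ℂ} (hY : f '' (ball (0 : ℂ) 1 ∩ sphere (-1) r) ⊆ Y) (h0 : (0 : ℂ) ∈ U \ Y) {z : ℂ}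
    (hz : z ∈ ball (0 : ℂ) 1) (hzr : z ∈ ball (-1 : ℂ) r) :
    f z ∉ connectedComponentIn (U \ Y) 0 := by
  intro hmem
  set S := connectedComponentIn (U \ Y) 0 with hS
  have hSU : S ⊆ U \ Y := connectedComponentIn_subset _ _
  have hpre : IsPreconnected ((fun w ↦ dist (g w) (-1)) '' S) :=
    isPreconnected_connectedComponentIn.image _
      ((continuous_id.dist continuous_const).comp_continuousOn
        (h.continuousOn.mono fun w hw ↦ (hSU hw).1))
  have hg0 : g 0 = 0 := by
    have := h.leftInvOn (mem_ball_self (one_pos : (0 : ℝ) < 1) : (0 : ℂ) ∈ ball 0 1)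
    rwa [h.map_zero] at this
  have m0 : (1 : ℝ) ∈ (fun w ↦ dist (g w) (-1)) '' S :=
    ⟨0, mem_connectedComponentIn h0, by simp [hg0]⟩
  have mz : dist z (-1) ∈ (fun w ↦ dist (g w) (-1)) '' S :=
    ⟨f z, hmem, by simp only; rw [h.leftInvOn hz]⟩
  obtain ⟨w, hw, hwr⟩ := hpre.ordConnected.out mz m0 ⟨(mem_ball.1 hzr).le, hr.2.le⟩
  refine (hSU hw).2 (hY ⟨g w, ⟨h.mapsTo_inv (hSU hw).1, hwr⟩, h.rightInvOn (hSU hw).1⟩)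

theorem exists_tendsto_neg_one (h : IsRiemannMap U f g) (hU : IsOpen U)
    (hb : Bornology.IsBounded U) (hcut : SmallCutsProperty U) :
    ∃ y, Tendsto f (𝓝[ball 0 1] (-1)) (𝓝 y) := by
  have : (𝓝[ball (0 : ℂ) 1] (-1)).NeBot := by
    rw [← mem_closure_iff_nhdsWithin_neBot, closure_ball _ one_ne_zero]
    simp
  rw [← cauchy_map_iff_exists_tendsto, Metric.cauchy_iff]
  refine ⟨inferInstance, fun ε hε ↦ ?_⟩
  obtain ⟨δ, hδ, hδε⟩ := hcut (ε / 2) (half_pos hε)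
  have hvol : volume (f '' ball 0 1) ≠ ∞ :=
    ((hb.subset h.mapsTo.image_subset).measure_lt_top).ne
  obtain ⟨r, hr, hosc⟩ := exists_arc_dist_le h.differentiableOn h.leftInvOn.injOn hvol hδ
  set C := ball (0 : ℂ) 1 ∩ sphere (-1) r with hC
  have h01 : (0 : ℂ) ∈ ball (0 : ℂ) 1 := mem_ball_self one_pos
  have h0U : (0 : ℂ) ∈ U := h.map_zero ▸ h.mapsTo h01
  -- the arc is relatively closed in the disc, so its image is relatively closed in `U`
  have hYC : closure (f '' C) ∩ U ⊆ f '' C := by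
    rintro y ⟨hy, hyU⟩
    have hgy : g y ∈ closure (g '' (f '' C)) :=
      ((h.continuousOn.continuousAt (hU.mem_nhds hyU)).continuousWithinAt).mem_closure_image hy
    have hsub : g '' (f '' C) ⊆ sphere (-1) r := by
      rintro _ ⟨_, ⟨z, hz, rfl⟩, rfl⟩
      rw [h.leftInvOn hz.1]
      exact hz.2
    exact ⟨g y, ⟨h.mapsTo_inv hyU, closure_minimal hsub isClosed_sphere hgy⟩, h.rightInvOn hyU⟩
  have h0Y : (0 : ℂ) ∉ closure (f '' C) := by
    intro h0
    obtain ⟨z, hz, hz0⟩ := hYC ⟨h0, h0U⟩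
    rw [← h.map_zero] at hz0
    have := h.leftInvOn.injOn hz.1 h01 hz0
    rw [this, mem_inter_iff, mem_sphere, dist_eq_norm] at hz
    have h2 := hz.2
    simp at h2
    exact hr.2.ne h2.symm
  have hA := hδε (f '' (ball 0 1 ∩ ball (-1) r)) (closure (f '' C)) ?_ ?_
    (h.closure_image_arc_inter_frontier_nonempty hb hr) h0Y ?_
  · refine ⟨f '' (ball 0 1 ∩ ball (-1) r), image_mem_map ?_, fun x hx y hy ↦ ?_⟩
    · exact inter_mem self_mem_nhdsWithin (mem_nhdsWithin_of_mem_nhds (ball_mem_nhds _ hr.1))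
    · have hxy := (edist_le_ediam_of_mem hx hy).trans hA
      rw [edist_dist, ENNReal.ofReal_le_ofReal_iff (by positivity)] at hxy
      linarith
  · rintro _ ⟨z, hz, rfl⟩
    exact h.mapsTo hz.1
  · rw [ediam_closure]
    refine ediam_le ?_
    rintro _ ⟨z, hz, rfl⟩ _ ⟨w, hw, rfl⟩
    rw [edist_dist]
    exact ENNReal.ofReal_le_ofReal (hosc z hz w hw)
  · rintro _ ⟨z, hz, rfl⟩ -
    exact h.notMem_connectedComponentIn hr subset_closure ⟨h0U, h0Y⟩ hz.1 hz.2

theorem exists_tendsto (h : IsRiemannMap U f g) (hU : IsOpen U)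
    (hb : Bornology.IsBounded U) (hcut : SmallCutsProperty U) {w : ℂ}
    (hw : w ∈ closedBall (0 : ℂ) 1) :
    ∃ y, Tendsto f (𝓝[ball 0 1] w) (𝓝 y) := by
  rcases (mem_closedBall_zero_iff.1 hw).lt_or_eq with hlt | heq
  · exact ⟨f w, h.differentiableOn.continuousOn w (mem_ball_zero_iff.2 hlt)⟩
  · have hw0 : w ≠ 0 := by rw [← norm_pos_iff, heq]; exact one_pos
    obtain ⟨y, hy⟩ :=
      (h.comp_rotation (c := -w) (by rwa [norm_neg])).exists_tendsto_neg_one hU hb hcut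
    refine ⟨y, ?_⟩
    have hrot : Tendsto (fun z ↦ (-w)⁻¹ * z) (𝓝[ball 0 1] w) (𝓝[ball 0 1] (-1)) := by
      have hc : Continuous fun z : ℂ ↦ (-w)⁻¹ * z := by fun_prop
      have h1 := hc.continuousWithinAt (s := ball 0 1) (x := w) |>.tendsto_nhdsWithin
        (t := ball 0 1) fun z hz ↦ by simpa [heq] using hz
      rwa [show (-w)⁻¹ * w = -1 by rw [inv_neg, neg_mul, inv_mul_cancel₀ hw0]] at h1
    refine (hy.comp hrot).congr fun z ↦ ?_
    simp only [Function.comp]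
    rw [mul_inv_cancel_left₀ (neg_ne_zero.2 hw0)]

/-- A Riemann map that has a limit at each boundary point parametrises the boundary. -/
theorem image_extendFrom_sphere (h : IsRiemannMap U f g) (hU : IsOpen U)
    (hlim : ∀ w ∈ closedBall (0 : ℂ) 1, ∃ y, Tendsto f (𝓝[ball 0 1] w) (𝓝 y)) :
    ContinuousOn (extendFrom (ball 0 1) f) (sphere 0 1) ∧
      extendFrom (ball 0 1) f '' sphere 0 1 = frontier U := by
  set F := extendFrom (ball (0 : ℂ) 1) f with hF
  have hcl : closure (ball (0 : ℂ) 1) = closedBall 0 1 := closure_ball _ one_ne_zero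
  have hFc : ContinuousOn F (closedBall 0 1) := continuousOn_extendFrom hcl.ge hlim
  have hFf : EqOn F f (ball 0 1) := fun z hz ↦
    extendFrom_eq (subset_closure hz) (h.differentiableOn.continuousOn z hz)
  have himg : F '' ball 0 1 = U := by
    rw [hFf.image_eq]
    exact h.mapsTo.image_subset.antisymm fun u hu ↦ ⟨g u, h.mapsTo_inv hu, h.rightInvOn hu⟩
  have hFU : F '' closedBall 0 1 = closure U := by
    refine Subset.antisymm ?_ ?_
    · rw [← himg, ← hcl]
      exact (hcl ▸ hFc).image_closure
    · refine closure_minimal ?_ ((isCompact_closedBall _ _).image_of_continuousOn hFc).isClosed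
      rw [← himg]
      exact image_mono ball_subset_closedBall
  refine ⟨hFc.mono sphere_subset_closedBall, Subset.antisymm ?_ ?_⟩
  · rintro _ ⟨w, hw, rfl⟩
    have hwc := sphere_subset_closedBall hw
    rw [hU.frontier_eq]
    refine ⟨hFU ▸ mem_image_of_mem F hwc, fun hFw ↦ ?_⟩
    -- otherwise `g (F w)` would be both `w` and a point of the open disc
    have hne : (𝓝[ball (0 : ℂ) 1] w).NeBot := mem_closure_iff_nhdsWithin_neBot.1 (hcl ▸ hwc)
    have h1 : Tendsto f (𝓝[ball 0 1] w) (𝓝 (F w)) := tendsto_extendFrom (hlim w hwc)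
    have h2 := (h.continuousOn.continuousAt (hU.mem_nhds hFw)).tendsto.comp h1
    have h3 : Tendsto (g ∘ f) (𝓝[ball 0 1] w) (𝓝 w) := by
      refine (tendsto_id.mono_left nhdsWithin_le_nhds).congr' ?_
      filter_upwards [self_mem_nhdsWithin] with z hz using (h.leftInvOn hz).symm
    have h4 := h.mapsTo_inv hFw
    rw [tendsto_nhds_unique h2 h3, mem_ball_zero_iff, mem_sphere_zero_iff_norm.1 hw] at h4
    exact h4.false
  · intro y hy
    rw [hU.frontier_eq, ← hFU] at hy
    obtain ⟨⟨w, hw, rfl⟩, hwU⟩ := hy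
    refine ⟨w, ?_, rfl⟩
    rcases (mem_closedBall_zero_iff.1 hw).lt_or_eq with hlt | heq
    · exact absurd (himg ▸ mem_image_of_mem F (mem_ball_zero_iff.2 hlt)) hwU
    · exact mem_sphere_zero_iff_norm.2 heq

end IsRiemannMap

end

/-- Criterion for a domain boundary to be a curve: if `U ⊊ ℂ` is a bounded simply connected
domain containing `0` with compact boundary, and for every `ε > 0` there is `δ > 0` such that
every subset of `U` disconnected from `0` in `U` by a set `Y` of Euclidean diameter at most `δ`
with `Y ∩ ∂U ≠ ∅` has Euclidean diameter at most `ε`, then `∂U` is the image of a continuous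
curve, i.e. there is a continuous surjection from the unit circle onto `∂U`. -/
theorem boundary_is_curve (U : Set ℂ) (hUopen : IsOpen U) (hUconn : IsConnected U)
    (h0 : (0 : ℂ) ∈ U) (hUne : U ≠ Set.univ) (hUbd : Bornology.IsBounded U)
    (hUsc : SimplyConnectedSpace U) (hfr : IsCompact (frontier U))
    (hyp : ∀ ε : ℝ, 0 < ε → ∃ δ : ℝ, 0 < δ ∧ ∀ A Y : Set ℂ, A ⊆ U →
      EMetric.diam Y ≤ ENNReal.ofReal δ → (Y ∩ frontier U).Nonempty → (0 : ℂ) ∉ Y →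
      (∀ a ∈ A, a ∉ Y → a ∉ connectedComponentIn (U \ Y) 0) →
      EMetric.diam A ≤ ENNReal.ofReal ε) :
    ∃ γ : ℂ → ℂ, ContinuousOn γ (Metric.sphere (0 : ℂ) 1) ∧
      γ '' Metric.sphere (0 : ℂ) 1 = frontier U := by
  obtain ⟨f, g, hfg⟩ := exists_isRiemannMap hUopen hUsc hUconn.isPreconnected hUbd h0
  exact ⟨_, hfg.image_extendFrom_sphere hUopen fun w hw ↦ hfg.exists_tendsto hUopen hUbd hyp hw⟩
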